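/- For all natural numbers n, r ≥ 0 and any real number x, the Carlitz degenerate Euler polynomial of order r and the degenerate Genocchi polynomial of order r satisfy 𝓔_{n,λ}^{(r)}(x) = G_{n+r,λ}^{(r)}(x) / (r! · C(n+r, n)). -/

import Mathlib

/-!
Relation between the Carlitz degenerate Euler polynomials of order `r` and the
degenerate Genocchi polynomials of order `r` (Kim–Kim–Kim–Kwon, identity (19)).
-/

open PowerSeries Finset

noncomputable section

/-- The degenerate falling factorial `(x)_{n,λ} = ∏_{i<n} (x - iλ)`. -/
def dff (lam x : ℝ) (n : ℕ) : ℝ := ∏ i ∈ Finset.range n, (x - i * lam)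

/-- The degenerate exponential `e_λ^x(t) = Σ_{n≥0} (x)_{n,λ} tⁿ/n!` as a formal power series. -/
def degExp (lam x : ℝ) : PowerSeries ℝ := PowerSeries.mk fun n => dff lam x n / n.factorial

theorem degExp_add_one_ne_zero (lam x : ℝ) : degExp lam x + 1 ≠ 0 := by
  intro h
  have h0 := congrArg (PowerSeries.coeff 0) h
  norm_num [degExp, dff] at h0

/-- **Identity (19).** For all `n, r ≥ 0` and `x ∈ ℝ`,
`𝓔_{n,λ}^{(r)}(x) = G_{n+r,λ}^{(r)}(x) / (r! · C(n+r,n))`, where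
`E n = 𝓔_{n,λ}^{(r)}(x)` is the Carlitz degenerate Euler polynomial of order `r`
(defined by `(2/(e_λ(t)+1))^r e_λ^x(t) = Σ 𝓔_{n,λ}^{(r)}(x) tⁿ/n!`) and
`G n = G_{n,λ}^{(r)}(x)` is the degenerate Genocchi polynomial of order `r`
(defined by `(2t/(e_λ(t)+1))^r e_λ^x(t) = Σ G_{n,λ}^{(r)}(x) tⁿ/n!`); the defining
identities are stated multiplicatively after clearing the denominator
`(e_λ(t)+1)^r`, whose constant term `2^r` is invertible. -/
theorem degenerate_Euler_eq_degenerate_Genocchi_div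
    (lam : ℝ) (hlam : lam ≠ 0) (r : ℕ) (x : ℝ)
    (E : ℕ → ℝ)
    (hE : ((2 : ℝ) ^ r) • degExp lam x
        = (PowerSeries.mk fun m => E m / m.factorial) * (degExp lam 1 + 1) ^ r)
    (G : ℕ → ℝ)
    (hG : ((2 : ℝ) • (PowerSeries.X : PowerSeries ℝ)) ^ r * degExp lam x
        = (PowerSeries.mk fun m => G m / m.factorial) * (degExp lam 1 + 1) ^ r)
    (n : ℕ) :
    E n = G (n + r) / ((r.factorial : ℝ) * ((n + r).choose n : ℝ)) := by
  have hmk : (PowerSeries.mk fun m => G m / m.factorial)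
      = PowerSeries.X ^ r * PowerSeries.mk fun m => E m / m.factorial := by
    apply mul_right_cancel₀ (pow_ne_zero r (degExp_add_one_ne_zero lam 1))
    rw [← hG, mul_assoc, ← hE, smul_pow, smul_mul_assoc, mul_smul_comm]
  have hcoeff := congrArg (PowerSeries.coeff (n + r)) hmk
  rw [PowerSeries.coeff_X_pow_mul, PowerSeries.coeff_mk, PowerSeries.coeff_mk] at hcoeff
  have hfact : ((n + r).choose n : ℝ) * n.factorial * r.factorial = (n + r).factorial := by
    rw [Nat.choose_symm_add]
    exact_mod_cast Nat.add_choose_mul_factorial_mul_factorial n r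
  have hn : (n.factorial : ℝ) ≠ 0 := by positivity
  have hr : (r.factorial : ℝ) ≠ 0 := by positivity
  have hc : ((n + r).choose n : ℝ) ≠ 0 := by
    exact_mod_cast (Nat.choose_pos (Nat.le_add_right n r)).ne'
  rw [← hfact] at hcoeff
  field_simp at hcoeff ⊢
  linarith
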